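/- Let P₁ and P₂ be orthogonal projections on a complex Hilbert space with P₁P₂ = P₂P₁, let ψ be a vector, and let 0 < δ ≤ 1 be such that ‖P₁P₂ψ‖² ≥ δ² and 0 < ‖P₁ψ‖² ≤ δ. Then ‖P₂ (P₁ψ / ‖P₁ψ‖)‖² ≥ δ. -/

import Mathlib

/-- Post-selection inequality: for commuting orthogonal projections `P₁, P₂` with
`‖P₁P₂ψ‖² ≥ δ²` and `0 < ‖P₁ψ‖² ≤ δ`, the normalized post-selected state
`P₁ψ / ‖P₁ψ‖` passes `P₂` with probability at least `δ`. -/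
theorem postselection_boost
    {H : Type*} [NormedAddCommGroup H] [InnerProductSpace ℂ H] [CompleteSpace H]
    (P₁ P₂ : H →L[ℂ] H)
    (hP₁proj : P₁ ∘L P₁ = P₁) (hP₁sa : IsSelfAdjoint P₁)
    (hP₂proj : P₂ ∘L P₂ = P₂) (hP₂sa : IsSelfAdjoint P₂)
    (hcomm : P₁ ∘L P₂ = P₂ ∘L P₁)
    (ψ : H) (δ : ℝ) (hδ0 : 0 < δ) (hδ1 : δ ≤ 1)
    (h12 : δ ^ 2 ≤ ‖P₁ (P₂ ψ)‖ ^ 2)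
    (h1pos : 0 < ‖P₁ ψ‖ ^ 2) (h1le : ‖P₁ ψ‖ ^ 2 ≤ δ) :
    δ ≤ ‖P₂ ((‖P₁ ψ‖)⁻¹ • P₁ ψ)‖ ^ 2 := by
  have hswap : P₁ (P₂ ψ) = P₂ (P₁ ψ) := DFunLike.congr_fun hcomm ψ
  rw [P₂.map_smul_of_tower, norm_smul, norm_inv, norm_norm, mul_pow, inv_pow, ← hswap,
    inv_mul_eq_div, le_div_iff₀ h1pos]
  calc δ * ‖P₁ ψ‖ ^ 2 ≤ δ * δ := by gcongr
    _ = δ ^ 2 := (sq δ).symm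
    _ ≤ ‖P₁ (P₂ ψ)‖ ^ 2 := h12
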